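/- arXiv:1211.3313 — 8 statements merged into one kernel-verified Lean document; each statement's English description precedes it below -/
import Mathlib

section
/- Bonferroni–Shaffer form of the sequential rejection principle. Let ℋ be finite and suppose raw p-values {p_H}_{H∈ℋ} and a critical value function α_H(·) are given such that: (i) monotonicity: α_H(ℛ) ≤ α_H(𝒮) for every ℛ ⊆ 𝒮 ⊊ ℋ and every H ∈ ℋ \ 𝒮; and (ii) for every M ∈ 𝕄, Σ_{H ∈ 𝒯(M)} α_H(ℱ(M)) ≤ α. Then the sequentially rejective procedure with successor function 𝒩(ℛ) = {H ∈ ℋ \ ℛ : p_H ≤ α_H(ℛ)} satisfies P_M(ℛ_∞ ⊆ ℱ(M)) ≥ 1 − α for every M ∈ 𝕄. -/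
open MeasureTheory Set Classical

/-- The sequentially rejective procedure based on a (possibly random) successor
function `N`: `ℛ₀ = ∅`, `ℛ_{i+1} = ℛ_i ∪ N(ℛ_i)`. -/
def seqRej {ι Ω : Type*} (N : Set ι → Ω → Set ι) (ω : Ω) : ℕ → Set ι
  | 0 => ∅
  | n + 1 => seqRej N ω n ∪ N (seqRej N ω n) ω

/-- If every successor of a subset of `F` stays inside `F`, then so do all rejected sets. -/
theorem seqRej_subset_of_successor_subset {ι Ω : Type*} {N : Set ι → Ω → Set ι} {ω : Ω}
    {F : Set ι} (h : ∀ R ⊆ F, N R ω ⊆ F) (n : ℕ) : seqRej N ω n ⊆ F := by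
  induction n with
  | zero => exact Set.empty_subset F
  | succ n ih => exact Set.union_subset ih (h _ ih)

/-- Bonferroni bound for the event that some p-value in a finite family is at most its level. -/
theorem measure_exists_pvalue_le {ι Ω : Type*} [MeasurableSpace Ω] (μ : Measure Ω)
    (T : Finset ι) (p : ι → Ω → ℝ) (c : ι → ℝ) (hc : ∀ i ∈ T, 0 ≤ c i)
    (hp : ∀ i ∈ T, μ {ω | p i ω ≤ c i} ≤ ENNReal.ofReal (c i)) :
    μ (⋃ i ∈ T, {ω | p i ω ≤ c i}) ≤ ENNReal.ofReal (∑ i ∈ T, c i) := by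
  rw [ENNReal.ofReal_sum_of_nonneg hc]
  exact (measure_biUnion_finset_le T _).trans (Finset.sum_le_sum hp)

/-- **Bonferroni–Shaffer form of the sequential rejection principle.**
Hypotheses are indexed by the finite type `ι` (`hyp i ⊆ 𝕄` is the `i`-th null
hypothesis); `p i` are raw p-values and `a i R` the critical values.  If the
critical value function is monotone (`a i R ≤ a i S` for `R ⊆ S ⊊ ℋ`, `i ∉ S`) and
`∑_{i ∈ 𝒯(M)} a i (ℱ(M)) ≤ α` for every `M`, then the sequentially rejective
procedure with `N(R) = {i ∉ R : p i ≤ a i R}` controls the FWER at level `α`. -/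
theorem bonferroni_shaffer_sequential_rejection
    {Ω : Type*} [MeasurableSpace Ω] {𝕄 : Type*} {ι : Type*} [Fintype ι]
    (P : 𝕄 → Measure Ω) (hP : ∀ M, IsProbabilityMeasure (P M))
    (hyp : ι → Set 𝕄) (hproper : ∀ i, hyp i ≠ Set.univ)
    (α : ℝ) (hα0 : 0 ≤ α) (hα1 : α ≤ 1)
    (p : ι → Ω → ℝ) (hpmeas : ∀ i, Measurable (p i))
    (hprange : ∀ i ω, p i ω ∈ Set.Icc (0 : ℝ) 1)
    (hpval : ∀ (M : 𝕄) (i : ι), M ∈ hyp i → ∀ u ∈ Set.Icc (0 : ℝ) 1,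
      P M {ω | p i ω ≤ u} ≤ ENNReal.ofReal u)
    (a : ι → Set ι → ℝ) (harange : ∀ i R, a i R ∈ Set.Icc (0 : ℝ) 1)
    (hamono : ∀ R S : Set ι, R ⊆ S → S ≠ Set.univ → ∀ i ∉ S, a i R ≤ a i S)
    (hsum : ∀ M : 𝕄,
      ∑ i ∈ Finset.univ.filter (fun i => M ∈ hyp i), a i {j | M ∉ hyp j} ≤ α)
    (N : Set ι → Ω → Set ι)
    (hN : ∀ R ω, N R ω = {i | i ∉ R ∧ p i ω ≤ a i R}) :
    ∀ M : 𝕄,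
      1 - ENNReal.ofReal α ≤ P M {ω | (⋃ n, seqRej N ω n) ⊆ {i | M ∉ hyp i}} := by
  intro M
  have := hP M
  set F : Set ι := {i | M ∉ hyp i}
  set T : Finset ι := Finset.univ.filter (fun i => M ∈ hyp i)
  set B : Set Ω := ⋃ i ∈ T, {ω | p i ω ≤ a i F}
  have hBmeas : MeasurableSet B :=
    T.measurableSet_biUnion fun i _ => measurableSet_le (hpmeas i) measurable_const
  have hBle : P M B ≤ ENNReal.ofReal α := by
    refine (measure_exists_pvalue_le (P M) T p (fun i => a i F)
      (fun i _ => (harange i F).1) fun i hi => ?_).trans (ENNReal.ofReal_le_ofReal (hsum M))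
    exact hpval M i (Finset.mem_filter.mp hi).2 _ (harange i F)
  have hsub : Bᶜ ⊆ {ω | (⋃ n, seqRej N ω n) ⊆ F} := by
    intro ω hω
    refine Set.iUnion_subset (seqRej_subset_of_successor_subset fun R hR i hi => ?_)
    rw [hN] at hi
    by_contra hiF
    have hle : a i R ≤ a i F :=
      hamono R F hR (fun h => hiF (h ▸ Set.mem_univ i)) i hiF
    have hiT : i ∈ T := Finset.mem_filter.mpr ⟨Finset.mem_univ i, not_not.mp hiF⟩
    exact hω (Set.mem_biUnion hiT (hi.2.trans hle))
  calc 1 - ENNReal.ofReal α ≤ 1 - P M B := tsub_le_tsub_left hBle 1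
    _ = P M Bᶜ := (prob_compl_eq_one_sub hBmeas).symm
    _ ≤ _ := measure_mono hsub
end

section
/- FWER control of Shaffer's S2 procedure. Let ℋ be finite and suppose raw p-values {p_H}_{H∈ℋ} are given. Define, for ℛ ⊆ ℋ and H ∈ ℋ, α_H(ℛ) = min{α/|𝒯(M)| : M ∈ 𝕄, 𝒯(M) ∩ ℛ = ∅, 𝒯(M) ≠ ∅}, with the convention α_H(ℛ) = 1 if no M ∈ 𝕄 has 𝒯(M) ∩ ℛ = ∅ and 𝒯(M) ≠ ∅. Then the sequentially rejective procedure with successor function 𝒩(ℛ) = {H ∈ ℋ \ ℛ : p_H ≤ α_H(ℛ)} satisfies P_M(ℛ_∞ ⊆ ℱ(M)) ≥ 1 − α for every M ∈ 𝕄. -/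
open MeasureTheory Set Classical

/-- **FWER control of Shaffer's S2 procedure.**  Hypotheses are indexed by the
finite type `ι` (`hyp i ⊆ 𝕄`); `𝒯(M) = {i | M ∈ hyp i}`.  The critical value is
`a R = min {α/|𝒯(M)| : M ∈ 𝕄, 𝒯(M) ∩ R = ∅, 𝒯(M) ≠ ∅}` (and `a R = 1` if no such
`M` exists).  The sequentially rejective procedure with successor
`N(R) = {i ∉ R : p i ≤ a R}` controls the FWER at level `α`. -/
theorem shaffer_S2_fwer_control
    {Ω : Type*} [MeasurableSpace Ω] {𝕄 : Type*} {ι : Type*} [Fintype ι]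
    (P : 𝕄 → Measure Ω) (hP : ∀ M, IsProbabilityMeasure (P M))
    (hyp : ι → Set 𝕄) (hproper : ∀ i, hyp i ≠ Set.univ)
    (α : ℝ) (hα0 : 0 ≤ α) (hα1 : α ≤ 1)
    (p : ι → Ω → ℝ) (hpmeas : ∀ i, Measurable (p i))
    (hprange : ∀ i ω, p i ω ∈ Set.Icc (0 : ℝ) 1)
    (hpval : ∀ (M : 𝕄) (i : ι), M ∈ hyp i → ∀ u ∈ Set.Icc (0 : ℝ) 1,
      P M {ω | p i ω ≤ u} ≤ ENNReal.ofReal u)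
    (a : Set ι → ℝ)
    (ha1 : ∀ R : Set ι,
      (∃ M : 𝕄, (∀ i, M ∈ hyp i → i ∉ R) ∧ (∃ i, M ∈ hyp i)) →
      a R = sInf {x : ℝ | ∃ M : 𝕄, (∀ i, M ∈ hyp i → i ∉ R) ∧ (∃ i, M ∈ hyp i) ∧
        x = α / ((Finset.univ.filter (fun i => M ∈ hyp i)).card : ℝ)})
    (ha2 : ∀ R : Set ι,
      (¬ ∃ M : 𝕄, (∀ i, M ∈ hyp i → i ∉ R) ∧ (∃ i, M ∈ hyp i)) → a R = 1)
    (N : Set ι → Ω → Set ι)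
    (hN : ∀ R ω, N R ω = {i | i ∉ R ∧ p i ω ≤ a R}) :
    ∀ M : 𝕄,
      1 - ENNReal.ofReal α ≤ P M {ω | (⋃ n, seqRej N ω n) ⊆ {i | M ∉ hyp i}} := by
  intro M
  have := hP M
  set T := Finset.univ.filter (fun i => M ∈ hyp i) with hT
  have mem_T : ∀ i, i ∈ T ↔ M ∈ hyp i := fun i => by simp [hT]
  set c : ℝ := α / (T.card : ℝ) with hc
  have hc0 : 0 ≤ c := by positivity
  have hc1 : c ≤ 1 := by
    rcases Nat.eq_zero_or_pos T.card with h | h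
    · simp [hc, h]
    · have h1 : (1 : ℝ) ≤ T.card := by exact_mod_cast h
      exact div_le_one_of_le₀ (hα1.trans h1) (by positivity)
  set B : Set Ω := ⋃ i ∈ T, {ω | p i ω ≤ c} with hB
  have hBmeas : MeasurableSet B :=
    Finset.measurableSet_biUnion _ fun i _ => measurableSet_le (hpmeas i) measurable_const
  have hBle : P M B ≤ ENNReal.ofReal α := by
    calc P M B ≤ ∑ i ∈ T, P M {ω | p i ω ≤ c} := measure_biUnion_finset_le _ _
      _ ≤ ∑ _i ∈ T, ENNReal.ofReal c :=
          Finset.sum_le_sum fun i hi => hpval M i ((mem_T i).1 hi) c ⟨hc0, hc1⟩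
      _ = ENNReal.ofReal (T.card * c) := by
          rw [Finset.sum_const, nsmul_eq_mul, ENNReal.ofReal_mul (Nat.cast_nonneg _),
            ENNReal.ofReal_natCast]
      _ ≤ ENNReal.ofReal α := ENNReal.ofReal_le_ofReal (by
          rw [hc, mul_comm]
          rcases eq_or_ne (T.card : ℝ) 0 with h | h
          · simpa [h] using hα0
          · exact (div_mul_cancel₀ α h).le)
  have hsub : Bᶜ ⊆ {ω | (⋃ n, seqRej N ω n) ⊆ {i | M ∉ hyp i}} := by
    intro ω hω
    have hlt : ∀ i, M ∈ hyp i → c < p i ω := by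
      intro i hi
      by_contra! h
      exact hω (mem_iUnion₂.2 ⟨i, (mem_T i).2 hi, h⟩)
    refine iUnion_subset fun n => ?_
    induction n with
    | zero => exact empty_subset _
    | succ n ih =>
      refine union_subset ih fun i hi hMi => ?_
      rw [hN] at hi
      have hR : ∀ j, M ∈ hyp j → j ∉ seqRej N ω n := fun j hj hjR => ih hjR hj
      have hle : a (seqRej N ω n) ≤ c := by
        rw [ha1 _ ⟨M, hR, i, hMi⟩]
        refine csInf_le ⟨0, ?_⟩ ⟨M, hR, ⟨i, hMi⟩, rfl⟩
        rintro x ⟨M', -, -, rfl⟩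
        positivity
      exact absurd (hi.2.trans hle) (hlt i hMi).not_ge
  calc 1 - ENNReal.ofReal α ≤ 1 - P M B := tsub_le_tsub_left hBle 1
    _ = P M Bᶜ := (prob_compl_eq_one_sub hBmeas).symm
    _ ≤ _ := measure_mono hsub
end

section
/- FWER control of the closed testing procedure as a sequentially rejective procedure. Let ℋ be finite and closed under nonempty intersection: for all H, J ∈ ℋ with H ∩ J ≠ ∅ one has H ∩ J ∈ ℋ. For H ∈ ℋ let i(H) = {J ∈ ℋ : J ⊊ H} be the set of implying null hypotheses. Suppose raw p-values {p_H}_{H∈ℋ} are given, and define α_H(ℛ) = α if i(H) ⊆ ℛ and α_H(ℛ) = 0 otherwise. Then the sequentially rejective procedure with successor function 𝒩(ℛ) = {H ∈ ℋ \ ℛ : p_H ≤ α_H(ℛ)} satisfies P_M(ℛ_∞ ⊆ ℱ(M)) ≥ 1 − α for every M ∈ 𝕄. -/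
open MeasureTheory Set Classical

/-- A finite family of sets that is closed under nonempty intersection has, for each point
lying in some member, a smallest member containing that point. -/
theorem exists_smallest_mem_of_inter_closed {X : Type*} (F : Finset (Set X))
    (hF : ∀ H ∈ F, ∀ J ∈ F, (H ∩ J).Nonempty → H ∩ J ∈ F) {x : X}
    (hx : ∃ H ∈ F, x ∈ H) :
    ∃ K ∈ F, x ∈ K ∧ ∀ H ∈ F, x ∈ H → K ⊆ H := by
  obtain ⟨H₀, hH₀, hxH₀⟩ := hx
  obtain ⟨K, hK⟩ := (F.filter (x ∈ ·)).exists_minimal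
    ⟨H₀, Finset.mem_filter.2 ⟨hH₀, hxH₀⟩⟩
  obtain ⟨hKF, hxK⟩ := Finset.mem_filter.1 hK.prop
  refine ⟨K, hKF, hxK, fun H hH hxH => ?_⟩
  have hmem : K ∩ H ∈ F.filter (x ∈ ·) :=
    Finset.mem_filter.2 ⟨hF K hKF H hH ⟨x, hxK, hxH⟩, hxK, hxH⟩
  exact (hK.le_of_le hmem inter_subset_left).trans inter_subset_right

/-- A sequentially rejective procedure stays inside `S` if no single step leaves `S`. -/
theorem iUnion_seqRej_subset {ι Ω : Type*} {N : Set ι → Ω → Set ι} {ω : Ω} {S : Set ι}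
    (h : ∀ R ⊆ S, N R ω ⊆ S) : (⋃ n, seqRej N ω n) ⊆ S := by
  refine iUnion_subset fun n => ?_
  induction n with
  | zero => exact empty_subset S
  | succ n ih => exact union_subset ih (h _ ih)

/-- **FWER control of the closed testing procedure as a sequentially rejective
procedure.**  Here `ℋ` is a finite collection of null hypotheses (proper subsets
of the model space `𝕄`) which is closed under nonempty intersection.  For
`H ∈ ℋ`, `i(H) = {J ∈ ℋ : J ⊊ H}` is the set of implying hypotheses, and the
critical value is `α` if `i(H) ⊆ ℛ` and `0` otherwise.  The sequentially
rejective procedure with successor `N(ℛ) = {H ∈ ℋ \ ℛ : p H ≤ α_H(ℛ)}` controls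
the FWER at level `α`: with probability at least `1 - α` only false hypotheses
(members of `ℱ(M) = {H ∈ ℋ : M ∉ H}`) are rejected. -/
theorem closed_testing_fwer_control
    {Ω : Type*} [MeasurableSpace Ω] {𝕄 : Type*}
    (P : 𝕄 → Measure Ω) (hP : ∀ M, IsProbabilityMeasure (P M))
    (ℋ : Finset (Set 𝕄)) (hproper : ∀ H ∈ ℋ, H ≠ Set.univ)
    (hclosed : ∀ H ∈ ℋ, ∀ J ∈ ℋ, (H ∩ J).Nonempty → H ∩ J ∈ ℋ)
    (α : ℝ) (hα0 : 0 ≤ α) (hα1 : α ≤ 1)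
    (p : Set 𝕄 → Ω → ℝ) (hpmeas : ∀ H, Measurable (p H))
    (hprange : ∀ H ω, p H ω ∈ Set.Icc (0 : ℝ) 1)
    (hpval : ∀ (M : 𝕄), ∀ H ∈ ℋ, M ∈ H → ∀ u ∈ Set.Icc (0 : ℝ) 1,
      P M {ω | p H ω ≤ u} ≤ ENNReal.ofReal u)
    (N : Set (Set 𝕄) → Ω → Set (Set 𝕄))
    (hN : ∀ R ω, N R ω = {H | H ∈ ℋ ∧ H ∉ R ∧
      p H ω ≤ (if ∀ J ∈ ℋ, J ⊂ H → J ∈ R then α else 0)}) :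
    ∀ M : 𝕄,
      1 - ENNReal.ofReal α ≤
        P M {ω | (⋃ n, seqRej N ω n) ⊆ {H | H ∈ ℋ ∧ M ∉ H}} := by
  intro M
  have := hP M
  by_cases hne : ∃ H ∈ ℋ, M ∈ H
  · obtain ⟨K, hK, hMK, hmin⟩ := exists_smallest_mem_of_inter_closed ℋ hclosed hne
    set B : Set Ω := {ω | p K ω ≤ α} ∪ ⋃ H ∈ ℋ.filter (M ∈ ·), {ω | p H ω ≤ 0}
    have hBmeas : MeasurableSet B :=
      (measurableSet_le (hpmeas K) measurable_const).union
        (Finset.measurableSet_biUnion _ fun H _ =>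
          measurableSet_le (hpmeas H) measurable_const)
    have hnull : P M (⋃ H ∈ ℋ.filter (M ∈ ·), {ω | p H ω ≤ 0}) = 0 := by
      refine (measure_biUnion_null_iff (Finset.countable_toSet _)).2 fun H hH => ?_
      obtain ⟨hH, hMH⟩ := Finset.mem_filter.1 hH
      simpa using hpval M H hH hMH 0 ⟨le_rfl, zero_le_one⟩
    have hBle : P M B ≤ ENNReal.ofReal α := by
      refine (measure_union_le _ _).trans ?_
      rw [hnull, add_zero]
      exact hpval M K hK hMK α ⟨hα0, hα1⟩
    calc 1 - ENNReal.ofReal α ≤ 1 - P M B := tsub_le_tsub_left hBle 1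
      _ = P M Bᶜ := (prob_compl_eq_one_sub hBmeas).symm
      _ ≤ _ := measure_mono fun ω hω => iUnion_seqRej_subset fun R hR H hH => ?_
    rw [hN] at hH
    obtain ⟨hHℋ, -, hp⟩ := hH
    refine ⟨hHℋ, fun hMH => hω ?_⟩
    split_ifs at hp with himp
    · rcases (hmin H hHℋ hMH).eq_or_ssubset with rfl | hKH
      · exact Or.inl hp
      · exact absurd hMK (hR (himp K hK hKH)).2
    · exact Or.inr (mem_biUnion (Finset.mem_filter.2 ⟨hHℋ, hMH⟩) hp)
  · have huniv : {ω | (⋃ n, seqRej N ω n) ⊆ {H | H ∈ ℋ ∧ M ∉ H}} = univ := by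
      refine eq_univ_of_forall fun ω => iUnion_seqRej_subset fun R _ H hH => ?_
      rw [hN] at hH
      exact ⟨hH.1, fun hMH => hne ⟨H, hH.1, hMH⟩⟩
    rw [huniv, measure_univ]
    exact tsub_le_self
end

section
/- FWER control of the step-down Šidák procedure. Let ℋ be finite and nonempty and suppose raw p-values {p_H}_{H∈ℋ} are given which additionally satisfy the Šidák inequality: for every M ∈ 𝕄 and all constants u_H ∈ [0,1], P_M(⋂_{H ∈ 𝒯(M)} {p_H > u_H}) ≥ ∏_{H ∈ 𝒯(M)} (1 − u_H). Define α_H(ℛ) = 1 − (1 − α)^{1/|ℋ \ ℛ|} for ℛ ⊊ ℋ. Then the sequentially rejective procedure with successor function 𝒩(ℛ) = {H ∈ ℋ \ ℛ : p_H ≤ α_H(ℛ)} satisfies P_M(ℛ_∞ ⊆ ℱ(M)) ≥ 1 − α for every M ∈ 𝕄. -/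
open MeasureTheory Set Classical

/-- If a successor function never rejects an element of `T` starting from a set disjoint
from `T`, then the sequentially rejective procedure never rejects an element of `T`. -/
lemma seqRej_disjoint {ι Ω : Type*} {N : Set ι → Ω → Set ι} {ω : Ω} {T : Set ι}
    (h : ∀ R, Disjoint R T → Disjoint (N R ω) T) (n : ℕ) : Disjoint (seqRej N ω n) T := by
  induction n with
  | zero => simp [seqRej]
  | succ n ih => exact Disjoint.union_left ih (h _ ih)

/-- The Šidák critical value `1 - (1 - α) ^ (1 / m)` is antitone in `m`. -/
lemma sidak_critical_value_anti {α : ℝ} (hα0 : 0 ≤ α) (hα1 : α ≤ 1) {k m : ℕ} (hk : 0 < k)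
    (hkm : k ≤ m) :
    1 - (1 - α) ^ ((1 : ℝ) / (m : ℝ)) ≤ 1 - (1 - α) ^ ((1 : ℝ) / (k : ℝ)) := by
  have hk' : (0 : ℝ) < k := by exact_mod_cast hk
  have hkm' : (k : ℝ) ≤ m := by exact_mod_cast hkm
  exact sub_le_sub_left (Real.rpow_le_rpow_of_exponent_ge' (by linarith) (by linarith)
    (by positivity) (one_div_le_one_div_of_le hk' hkm')) 1

/-- **FWER control of the step-down Šidák procedure.**  Hypotheses are indexed by
the finite nonempty type `ι` (`hyp i ⊆ 𝕄`); `𝒯(M) = {i | M ∈ hyp i}`.  The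
p-values satisfy the Šidák inequality
`P_M(⋂_{i ∈ 𝒯(M)} {p i > u i}) ≥ ∏_{i ∈ 𝒯(M)} (1 - u i)`.  The critical value is
`α_H(ℛ) = 1 - (1 - α)^(1/|ℋ \ ℛ|)`, and the sequentially rejective procedure with
successor `N(ℛ) = {i ∉ ℛ : p i ≤ α_H(ℛ)}` controls the FWER at level `α`. -/
theorem stepdown_sidak_fwer_control
    {Ω : Type*} [MeasurableSpace Ω] {𝕄 : Type*} {ι : Type*} [Fintype ι]
    [Nonempty ι]
    (P : 𝕄 → Measure Ω) (hP : ∀ M, IsProbabilityMeasure (P M))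
    (hyp : ι → Set 𝕄) (hproper : ∀ i, hyp i ≠ Set.univ)
    (α : ℝ) (hα0 : 0 ≤ α) (hα1 : α ≤ 1)
    (p : ι → Ω → ℝ) (hpmeas : ∀ i, Measurable (p i))
    (hprange : ∀ i ω, p i ω ∈ Set.Icc (0 : ℝ) 1)
    (hpval : ∀ (M : 𝕄) (i : ι), M ∈ hyp i → ∀ u ∈ Set.Icc (0 : ℝ) 1,
      P M {ω | p i ω ≤ u} ≤ ENNReal.ofReal u)
    (hsidak : ∀ (M : 𝕄) (u : ι → ℝ), (∀ i, u i ∈ Set.Icc (0 : ℝ) 1) →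
      ENNReal.ofReal (∏ i ∈ Finset.univ.filter (fun i => M ∈ hyp i), (1 - u i)) ≤
        P M {ω | ∀ i, M ∈ hyp i → u i < p i ω})
    (N : Set ι → Ω → Set ι)
    (hN : ∀ R ω, N R ω = {i | i ∉ R ∧
      p i ω ≤ 1 - (1 - α) ^ ((1 : ℝ) / (Set.ncard Rᶜ : ℝ))}) :
    ∀ M : 𝕄,
      1 - ENNReal.ofReal α ≤ P M {ω | (⋃ n, seqRej N ω n) ⊆ {i | M ∉ hyp i}} := by
  intro M
  set T : Finset ι := Finset.univ.filter (fun i => M ∈ hyp i) with hT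
  have h_nonneg : (0 : ℝ) ≤ 1 - α := by linarith
  have hmem (i : ι) : i ∈ T ↔ M ∈ hyp i := by simp [hT]
  set c : ℝ := 1 - (1 - α) ^ ((1 : ℝ) / (T.card : ℝ)) with hc
  have hc_mem : c ∈ Set.Icc (0 : ℝ) 1 := by
    have h0 : 0 ≤ (1 - α) ^ ((1 : ℝ) / (T.card : ℝ)) := Real.rpow_nonneg h_nonneg _
    have h1 : (1 - α) ^ ((1 : ℝ) / (T.card : ℝ)) ≤ 1 :=
      Real.rpow_le_one h_nonneg (by linarith) (by positivity)
    constructor <;> linarith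
  have hprod : 1 - α ≤ ∏ _i ∈ T, (1 - c) := by
    rw [Finset.prod_const, hc, sub_sub_cancel]
    rcases Nat.eq_zero_or_pos T.card with h | h
    · rw [h, pow_zero]
      linarith
    · rw [one_div, Real.rpow_inv_natCast_pow h_nonneg h.ne']
  have hsub : {ω | ∀ i, M ∈ hyp i → c < p i ω} ⊆
      {ω | (⋃ n, seqRej N ω n) ⊆ {i | M ∉ hyp i}} := by
    intro ω hω
    have hstep : ∀ R, Disjoint R (T : Set ι) → Disjoint (N R ω) (T : Set ι) := by
      intro R hR
      rw [Set.disjoint_left]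
      intro i hi hiT
      rw [hN] at hi
      have hcard : T.card ≤ Set.ncard Rᶜ := by
        rw [← Set.ncard_coe_finset]
        exact Set.ncard_le_ncard hR.subset_compl_left (Set.toFinite _)
      exact (hω i ((hmem i).1 hiT)).not_ge
        (hi.2.trans (sidak_critical_value_anti hα0 hα1 (Finset.card_pos.2 ⟨i, hiT⟩) hcard))
    refine Set.iUnion_subset fun n i hi hiM => ?_
    exact Set.disjoint_left.1 (seqRej_disjoint hstep n) hi ((hmem i).2 hiM)
  calc 1 - ENNReal.ofReal α = ENNReal.ofReal (1 - α) := by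
        rw [ENNReal.ofReal_sub _ hα0, ENNReal.ofReal_one]
    _ ≤ ENNReal.ofReal (∏ _i ∈ T, (1 - c)) := ENNReal.ofReal_le_ofReal hprod
    _ ≤ P M {ω | ∀ i, M ∈ hyp i → c < p i ω} := hsidak M (fun _ => c) fun _ => hc_mem
    _ ≤ P M {ω | (⋃ n, seqRej N ω n) ⊆ {i | M ∉ hyp i}} := measure_mono hsub
end

section
/- Sequential rejection principle for step-up procedures. Let ℋ be finite with raw p-values {p_H}_{H∈ℋ}, and for each ℛ ⊊ ℋ let α₁(ℛ) ≥ α₂(ℛ) ≥ … ≥ α_{|ℋ\ℛ|}(ℛ) be ordered critical values in [0,1]. Define the successor function 𝒩(ℛ) = ⋃{𝒦 ⊆ ℋ \ ℛ : p_H ≤ α_{|ℋ\(ℛ∪𝒦)|+1}(ℛ) for every H ∈ 𝒦}. Suppose: (i) whenever ℛ ⊆ 𝒮 ⊊ ℋ, α_i(𝒮) ≥ α_i(ℛ) for every i = 1, …, |ℋ\𝒮|; and (ii) for every M ∈ 𝕄 with 𝒯(M) ≠ ∅, P_M(⋃_{∅≠𝒦⊆𝒯(M)} {p_H ≤ α_{|𝒯(M)\𝒦|+1}(ℱ(M))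 for every H ∈ 𝒦}) ≤ α. Then the sequentially rejective procedure based on 𝒩 satisfies P_M(ℛ_∞ ⊆ ℱ(M)) ≥ 1 − α for every M ∈ 𝕄. -/
open MeasureTheory Set Classical

/-- If a set `K` of hypotheses outside `R ⊆ Tᶜ` passes the step-up criterion at `R`, then
`T ∩ K` passes the step-up criterion at `Tᶜ`. -/
theorem stepup_criterion_inter {ι : Type*} [Finite ι] (a : ℕ → Set ι → ℝ) (q : ι → ℝ)
    (hordered : ∀ (R : Set ι) (n m : ℕ), R ≠ Set.univ →
      1 ≤ n → n ≤ m → m ≤ Set.ncard Rᶜ → a m R ≤ a n R)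
    (hamono : ∀ R S : Set ι, R ⊆ S → S ≠ Set.univ →
      ∀ n : ℕ, 1 ≤ n → n ≤ Set.ncard Sᶜ → a n R ≤ a n S)
    {R T K : Set ι} (hRT : R ⊆ Tᶜ) (hKR : K ⊆ Rᶜ)
    (hK : ∀ i ∈ K, q i ≤ a (Set.ncard (R ∪ K)ᶜ + 1) R) :
    ∀ i ∈ T ∩ K, q i ≤ a (Set.ncard (T \ (T ∩ K)) + 1) Tᶜ := by
  rintro i ⟨hiT, hiK⟩
  have hTuniv : Tᶜ ≠ Set.univ := fun h => (h ▸ Set.mem_univ i : i ∈ Tᶜ) hiT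
  have hRuniv : R ≠ Set.univ := fun h => hKR hiK (h ▸ Set.mem_univ i)
  have hle : Set.ncard (T \ (T ∩ K)) ≤ Set.ncard (R ∪ K)ᶜ := by
    refine Set.ncard_le_ncard ?_ (Set.toFinite _)
    rintro j ⟨hjT, hjK⟩ (hj | hj)
    · exact hRT hj hjT
    · exact hjK ⟨hjT, hj⟩
  have hR : Set.ncard (R ∪ K)ᶜ < Set.ncard Rᶜ := by
    refine Set.ncard_lt_ncard ⟨?_, fun h => h (hKR hiK) (Or.inr hiK)⟩ (Set.toFinite _)
    exact Set.compl_subset_compl.2 Set.subset_union_left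
  have hT : Set.ncard (T \ (T ∩ K)) < Set.ncard Tᶜᶜ := by
    rw [compl_compl]
    exact Set.ncard_lt_ncard ⟨Set.sdiff_subset, fun h => (h hiT).2 ⟨hiT, hiK⟩⟩ (Set.toFinite _)
  calc q i ≤ a (Set.ncard (R ∪ K)ᶜ + 1) R := hK i hiK
    _ ≤ a (Set.ncard (T \ (T ∩ K)) + 1) R :=
      hordered R _ _ hRuniv (by omega) (by omega) (by omega)
    _ ≤ a (Set.ncard (T \ (T ∩ K)) + 1) Tᶜ :=
      hamono R Tᶜ hRT hTuniv _ (by omega) (by omega)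

/-- **Sequential rejection principle for step-up procedures.**  Hypotheses are
indexed by the finite type `ι` (`hyp i ⊆ 𝕄`); `𝒯(M) = {i | M ∈ hyp i}` and
`ℱ(M) = {i | M ∉ hyp i}`.  For `ℛ ⊊ ℋ`, `a n ℛ` (for `1 ≤ n ≤ |ℋ \ ℛ|`) are
ordered critical values in `[0,1]`, and the step-up successor is
`N(ℛ) = ⋃ {𝒦 ⊆ ℋ \ ℛ : p i ≤ a (|ℋ \ (ℛ ∪ 𝒦)| + 1) ℛ for all i ∈ 𝒦}`.
If the critical values are monotone in `ℛ` and the step-up single-step condition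
holds at `ℱ(M)` for every `M` with `𝒯(M) ≠ ∅`, then the procedure controls the
FWER at level `α`. -/
theorem stepup_sequential_rejection_principle
    {Ω : Type*} [MeasurableSpace Ω] {𝕄 : Type*} {ι : Type*} [Fintype ι]
    (P : 𝕄 → Measure Ω) (hP : ∀ M, IsProbabilityMeasure (P M))
    (hyp : ι → Set 𝕄) (hproper : ∀ i, hyp i ≠ Set.univ)
    (α : ℝ) (hα0 : 0 ≤ α) (hα1 : α ≤ 1)
    (p : ι → Ω → ℝ) (hpmeas : ∀ i, Measurable (p i))
    (hprange : ∀ i ω, p i ω ∈ Set.Icc (0 : ℝ) 1)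
    (hpval : ∀ (M : 𝕄) (i : ι), M ∈ hyp i → ∀ u ∈ Set.Icc (0 : ℝ) 1,
      P M {ω | p i ω ≤ u} ≤ ENNReal.ofReal u)
    (a : ℕ → Set ι → ℝ)
    (harange : ∀ (R : Set ι) (n : ℕ), R ≠ Set.univ → 1 ≤ n → n ≤ Set.ncard Rᶜ →
      a n R ∈ Set.Icc (0 : ℝ) 1)
    (hordered : ∀ (R : Set ι) (n m : ℕ), R ≠ Set.univ →
      1 ≤ n → n ≤ m → m ≤ Set.ncard Rᶜ → a m R ≤ a n R)
    (hamono : ∀ R S : Set ι, R ⊆ S → S ≠ Set.univ →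
      ∀ n : ℕ, 1 ≤ n → n ≤ Set.ncard Sᶜ → a n R ≤ a n S)
    (hsingle : ∀ M : 𝕄, {i : ι | M ∈ hyp i} ≠ ∅ →
      P M {ω | ∃ K : Set ι, K.Nonempty ∧ K ⊆ {i | M ∈ hyp i} ∧
          ∀ i ∈ K, p i ω ≤ a (Set.ncard ({i | M ∈ hyp i} \ K) + 1) {i | M ∉ hyp i}}
        ≤ ENNReal.ofReal α)
    (N : Set ι → Ω → Set ι)
    (hN : ∀ R ω, N R ω = ⋃₀ {K : Set ι | K ⊆ Rᶜ ∧
      ∀ i ∈ K, p i ω ≤ a (Set.ncard (R ∪ K)ᶜ + 1) R}) :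
    ∀ M : 𝕄,
      1 - ENNReal.ofReal α ≤ P M {ω | (⋃ n, seqRej N ω n) ⊆ {i | M ∉ hyp i}} := by
  intro M
  have := hP M
  rcases eq_or_ne {i : ι | M ∈ hyp i} ∅ with hT | hT
  · have huniv : {ω | (⋃ n, seqRej N ω n) ⊆ {i | M ∉ hyp i}} = Set.univ :=
      Set.eq_univ_of_forall fun _ i _ hi => Set.eq_empty_iff_forall_notMem.1 hT i hi
    rw [huniv, measure_univ]
    exact tsub_le_self
  rw [tsub_le_iff_right, ← measure_univ (μ := P M)]
  refine le_trans ?_ (add_le_add_right (hsingle M hT) _)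
  refine le_trans (measure_mono fun ω _ => ?_) (measure_union_le _ _)
  refine or_iff_not_imp_right.2 fun hE => Set.iUnion_subset fun n => ?_
  induction n with
  | zero => exact Set.empty_subset _
  | succ n ih =>
    refine Set.union_subset ih ?_
    rw [hN]
    refine Set.sUnion_subset ?_
    rintro K ⟨hKR, hK⟩ i hiK hiT
    exact hE ⟨{i | M ∈ hyp i} ∩ K, ⟨i, hiT, hiK⟩, Set.inter_subset_left,
      stepup_criterion_inter a (fun i => p i ω) hordered hamono ih hKR hK⟩
end

section
/- FWER control of serial gatekeeping with Holm in each family. Let ℋ be finite and partitioned into two disjoint nonempty families 𝒢₁ and 𝒢₂, and suppose raw p-values {p_H}_{H∈ℋ} are given. Define α_H(ℛ) = α/|𝒢₁ \ ℛ| if H ∈ 𝒢₁ (and 𝒢₁ ⊄ ℛ); α_H(ℛ) = α/|𝒢₂ \ ℛ| if H ∈ 𝒢₂ and 𝒢₁ ⊆ ℛ; and α_H(ℛ) = 0 otherwise. Then the sequentially rejective procedure with successor function 𝒩(ℛ) = {H ∈ ℋ \ ℛ : p_H ≤ α_H(ℛ)} satisfies P_M(ℛ_∞ ⊆ ℱ(M))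 ≥ 1 − α for every M ∈ 𝕄. -/
open MeasureTheory Set Classical

/-- If the successor function never rejects a hypothesis of `T` from a set disjoint from `T`,
then the procedure never rejects a hypothesis of `T`. -/
theorem iUnion_seqRej_subset_compl {ι Ω : Type*} {N : Set ι → Ω → Set ι} {T : Set ι} {ω : Ω}
    (h : ∀ R ⊆ Tᶜ, N R ω ⊆ Tᶜ) : (⋃ n, seqRej N ω n) ⊆ Tᶜ := by
  refine iUnion_subset fun n => ?_
  induction n with
  | zero => exact empty_subset _
  | succ n ih => exact union_subset ih (h _ ih)

/-- The critical value of the serial gatekeeping procedure, with Holm in each family. -/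
noncomputable def serialCritical {ι : Type*} (G1 G2 : Set ι) (α : ℝ) (R : Set ι) (i : ι) : ℝ :=
  if i ∈ G1 then α / (Set.ncard (G1 \ R) : ℝ)
    else if G1 ⊆ R then α / (Set.ncard (G2 \ R) : ℝ) else 0

theorem div_natCast_mem_Icc {α : ℝ} (hα0 : 0 ≤ α) (hα1 : α ≤ 1) (n : ℕ) :
    α / n ∈ Icc (0 : ℝ) 1 := by
  refine ⟨by positivity, ?_⟩
  rcases n.eq_zero_or_pos with rfl | hn
  · simp
  · exact (div_le_self hα0 (by exact_mod_cast hn)).trans hα1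

theorem serialCritical_mem_Icc {ι : Type*} (G1 G2 : Set ι) {α : ℝ} (hα0 : 0 ≤ α) (hα1 : α ≤ 1)
    (R : Set ι) (i : ι) : serialCritical G1 G2 α R i ∈ Icc (0 : ℝ) 1 := by
  unfold serialCritical
  split_ifs
  · exact div_natCast_mem_Icc hα0 hα1 _
  · exact div_natCast_mem_Icc hα0 hα1 _
  · simp

theorem div_ncard_diff_le {ι : Type*} [Finite ι] {α : ℝ} (hα0 : 0 ≤ α) {G R S : Set ι}
    (hRS : R ⊆ S) {i : ι} (hG : i ∈ G) (hS : i ∉ S) :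
    α / ((G \ R).ncard : ℝ) ≤ α / ((G \ S).ncard : ℝ) := by
  have hpos : 0 < (G \ S).ncard := (ncard_pos (toFinite _)).2 ⟨i, hG, hS⟩
  have hle : (G \ S).ncard ≤ (G \ R).ncard :=
    ncard_le_ncard (sdiff_subset_sdiff_right hRS) (toFinite _)
  exact div_le_div_of_nonneg_left hα0 (by exact_mod_cast hpos) (by exact_mod_cast hle)

/-- Critical values of unrejected hypotheses increase with the set of rejections. -/
theorem serialCritical_mono {ι : Type*} [Finite ι] {G1 G2 : Set ι} (hunion : G1 ∪ G2 = univ)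
    {α : ℝ} (hα0 : 0 ≤ α) {R S : Set ι} (hRS : R ⊆ S) {i : ι} (hS : i ∉ S) :
    serialCritical G1 G2 α R i ≤ serialCritical G1 G2 α S i := by
  unfold serialCritical
  by_cases h1 : i ∈ G1
  · simpa only [if_pos h1] using div_ncard_diff_le hα0 hRS h1 hS
  have h2 : i ∈ G2 := (hunion ▸ mem_univ i : i ∈ G1 ∪ G2).resolve_left h1
  simp only [if_neg h1]
  by_cases hR : G1 ⊆ R
  · simpa only [if_pos hR, if_pos (hR.trans hRS)] using div_ncard_diff_le hα0 hRS h2 hS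
  · rw [if_neg hR]
    split_ifs
    · positivity
    · exact le_rfl

theorem natCast_mul_div_le {α : ℝ} (hα0 : 0 ≤ α) (n : ℕ) : n * (α / n) ≤ α := by
  rcases n.eq_zero_or_pos with rfl | hn
  · simpa using hα0
  · have : (n : ℝ) ≠ 0 := by exact_mod_cast hn.ne'
    exact (mul_div_cancel₀ α this).le

/-- The critical values of the true hypotheses, when exactly the false ones have been rejected,
sum to at most `α`. -/
theorem sum_serialCritical_le {ι : Type*} {G1 G2 : Set ι} (hunion : G1 ∪ G2 = univ)
    {α : ℝ} (hα0 : 0 ≤ α) (T : Finset ι) :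
    ∑ i ∈ T, serialCritical G1 G2 α (T : Set ι)ᶜ i ≤ α := by
  unfold serialCritical
  by_cases h : G1 ⊆ (T : Set ι)ᶜ
  · have h1 : ∀ i ∈ T, i ∉ G1 := fun i hi hi1 => h hi1 hi
    have h2 : G2 \ (T : Set ι)ᶜ = T := by
      ext i
      have hi : i ∈ G1 ∪ G2 := hunion ▸ mem_univ i
      simp only [mem_sdiff, mem_compl_iff, not_not, Finset.mem_coe]
      exact ⟨And.right, fun hT => ⟨hi.resolve_left (h1 i hT), hT⟩⟩
    rw [Finset.sum_congr rfl fun i hi => by rw [if_neg (h1 i hi), if_pos h], h2,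
      ncard_coe_finset, Finset.sum_const, nsmul_eq_mul]
    exact natCast_mul_div_le hα0 _
  · have h1 : G1 \ (T : Set ι)ᶜ = (T.filter (· ∈ G1) : Finset ι) := by
      ext i
      simp [and_comm]
    simp only [if_neg h]
    rw [← Finset.sum_filter, Finset.sum_const, nsmul_eq_mul, h1, ncard_coe_finset]
    exact natCast_mul_div_le hα0 _

/-- The union bound for p-values, in terms of the event that none of them is small. -/
theorem one_sub_ofReal_le_measure_forall_lt {Ω ι : Type*} [MeasurableSpace Ω] {μ : Measure Ω}
    [IsProbabilityMeasure μ] {p : ι → Ω → ℝ} (hp : ∀ i, Measurable (p i)) (T : Finset ι)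
    {b : ι → ℝ} (hb : ∀ i, 0 ≤ b i) {α : ℝ} (hsum : ∑ i ∈ T, b i ≤ α)
    (hμ : ∀ i ∈ T, μ {ω | p i ω ≤ b i} ≤ ENNReal.ofReal (b i)) :
    1 - ENNReal.ofReal α ≤ μ {ω | ∀ i ∈ T, b i < p i ω} := by
  have hcompl : {ω | ∀ i ∈ T, b i < p i ω} = (⋃ i ∈ T, {ω | p i ω ≤ b i})ᶜ := by
    ext ω
    simp
  have hmeas : MeasurableSet (⋃ i ∈ T, {ω | p i ω ≤ b i}) :=
    T.measurableSet_biUnion fun i _ => measurableSet_le (hp i) measurable_const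
  rw [hcompl, prob_compl_eq_one_sub hmeas]
  refine tsub_le_tsub_left ?_ 1
  calc μ (⋃ i ∈ T, {ω | p i ω ≤ b i}) ≤ ∑ i ∈ T, μ {ω | p i ω ≤ b i} :=
        measure_biUnion_finset_le _ _
    _ ≤ ∑ i ∈ T, ENNReal.ofReal (b i) := Finset.sum_le_sum hμ
    _ = ENNReal.ofReal (∑ i ∈ T, b i) := (ENNReal.ofReal_sum_of_nonneg fun i _ => hb i).symm
    _ ≤ ENNReal.ofReal α := ENNReal.ofReal_le_ofReal hsum

/-- **FWER control of serial gatekeeping with Holm in each family.**  The finite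
hypothesis collection (indexed by `ι`, `hyp i ⊆ 𝕄`) is partitioned into two
disjoint nonempty families `G1` and `G2`.  The critical value is
`α / |G1 \ ℛ|` for `i ∈ G1`, `α / |G2 \ ℛ|` for `i ∈ G2` when `G1 ⊆ ℛ`, and `0`
otherwise.  The sequentially rejective procedure with successor
`N(ℛ) = {i ∉ ℛ : p i ≤ α_i(ℛ)}` controls the FWER at level `α`. -/
theorem serial_gatekeeping_fwer_control
    {Ω : Type*} [MeasurableSpace Ω] {𝕄 : Type*} {ι : Type*} [Fintype ι]
    (P : 𝕄 → Measure Ω) (hP : ∀ M, IsProbabilityMeasure (P M))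
    (hyp : ι → Set 𝕄) (hproper : ∀ i, hyp i ≠ Set.univ)
    (G1 G2 : Set ι) (hunion : G1 ∪ G2 = Set.univ) (hdisj : G1 ∩ G2 = ∅)
    (hne1 : G1.Nonempty) (hne2 : G2.Nonempty)
    (α : ℝ) (hα0 : 0 ≤ α) (hα1 : α ≤ 1)
    (p : ι → Ω → ℝ) (hpmeas : ∀ i, Measurable (p i))
    (hprange : ∀ i ω, p i ω ∈ Set.Icc (0 : ℝ) 1)
    (hpval : ∀ (M : 𝕄) (i : ι), M ∈ hyp i → ∀ u ∈ Set.Icc (0 : ℝ) 1,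
      P M {ω | p i ω ≤ u} ≤ ENNReal.ofReal u)
    (N : Set ι → Ω → Set ι)
    (hN : ∀ R ω, N R ω = {i | i ∉ R ∧
      p i ω ≤ (if i ∈ G1 then α / (Set.ncard (G1 \ R) : ℝ)
        else if G1 ⊆ R then α / (Set.ncard (G2 \ R) : ℝ) else 0)}) :
    ∀ M : 𝕄,
      1 - ENNReal.ofReal α ≤ P M {ω | (⋃ n, seqRej N ω n) ⊆ {i | M ∉ hyp i}} := by
  intro M
  have := hP M
  let T : Finset ι := Finset.univ.filter fun i => M ∈ hyp i
  have hT : (T : Set ι)ᶜ = {i | M ∉ hyp i} := by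
    ext i
    simp [T]
  have hb := serialCritical_mem_Icc G1 G2 hα0 hα1 (T : Set ι)ᶜ
  refine (one_sub_ofReal_le_measure_forall_lt hpmeas T (fun i => (hb i).1)
    (sum_serialCritical_le hunion hα0 T)
    fun i hi => hpval M i (Finset.mem_filter.1 hi).2 _ (hb i)).trans (measure_mono fun ω hω => ?_)
  rw [mem_ofPred_eq, ← hT]
  refine iUnion_seqRej_subset_compl fun R hR i hi hiT => ?_
  rw [hN] at hi
  have hle : p i ω ≤ serialCritical G1 G2 α R i := hi.2
  exact (hω i hiT).not_ge (hle.trans (serialCritical_mono hunion hα0 hR (not_not.2 hiT)))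
end

section
/- FWER control of parallel gatekeeping with Bonferroni in the first family and Holm in the second. Let ℋ be finite and partitioned into two disjoint nonempty families 𝒢₁ and 𝒢₂, and suppose raw p-values {p_H}_{H∈ℋ} are given. Define α_H(ℛ) = α/|𝒢₁| if H ∈ 𝒢₁, and α_H(ℛ) = (α·|ℛ ∩ 𝒢₁|)/(|𝒢₂ \ ℛ|·|𝒢₁|) if H ∈ 𝒢₂ (with 𝒢₂ ⊄ ℛ). Then the sequentially rejective procedure with successor function 𝒩(ℛ) = {H ∈ ℋ \ ℛ : p_H ≤ α_H(ℛ)} satisfies P_M(ℛ_∞ ⊆ ℱ(M)) ≥ 1 − α for every M ∈ 𝕄. -/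
open MeasureTheory Set Classical

/-- If the running rejected set of a sequentially rejective procedure eventually leaves `F`, there
is a stage contained in `F` at which the successor function selects an element outside `F`. -/
theorem exists_successor_notMem_of_not_iUnion_seqRej_subset {ι Ω : Type*} {N : Set ι → Ω → Set ι}
    {ω : Ω} {F : Set ι} (h : ¬ (⋃ n, seqRej N ω n) ⊆ F) :
    ∃ R ⊆ F, ∃ i ∈ N R ω, i ∉ F := by
  by_contra! hcon
  refine h (iUnion_subset fun n => ?_)
  induction n with
  | zero => exact empty_subset F
  | succ n ih => exact union_subset ih (hcon _ ih)

/-- A union bound: if every point outside `A` lies in some `E i` with `i ∈ T`, and the `E i` have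
measures bounded by `c i ≥ 0` with total at most `α`, then `A` has probability at least `1 - α`. -/
theorem one_sub_le_measure_of_compl_subset_biUnion {Ω ι : Type*} [MeasurableSpace Ω]
    (μ : Measure Ω) [IsProbabilityMeasure μ] {A : Set Ω} {T : Finset ι} {E : ι → Set Ω}
    {c : ι → ℝ} {α : ℝ} (hA : Aᶜ ⊆ ⋃ i ∈ T, E i) (hc : ∀ i ∈ T, 0 ≤ c i)
    (hE : ∀ i ∈ T, μ (E i) ≤ ENNReal.ofReal (c i)) (hsum : ∑ i ∈ T, c i ≤ α) :
    1 - ENNReal.ofReal α ≤ μ A := by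
  have hcompl : μ Aᶜ ≤ ENNReal.ofReal α :=
    calc μ Aᶜ ≤ μ (⋃ i ∈ T, E i) := measure_mono hA
      _ ≤ ∑ i ∈ T, μ (E i) := measure_biUnion_finset_le T E
      _ ≤ ∑ i ∈ T, ENNReal.ofReal (c i) := Finset.sum_le_sum hE
      _ = ENNReal.ofReal (∑ i ∈ T, c i) := (ENNReal.ofReal_sum_of_nonneg hc).symm
      _ ≤ ENNReal.ofReal α := ENNReal.ofReal_le_ofReal hsum
  rw [tsub_le_iff_right]
  calc (1 : ENNReal) = μ (A ∪ Aᶜ) := by rw [union_compl_self, measure_univ]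
    _ ≤ μ A + μ Aᶜ := measure_union_le A Aᶜ
    _ ≤ μ A + ENNReal.ofReal α := by gcongr

/-- **FWER control of parallel gatekeeping with Bonferroni in the first family
and Holm in the second.**  The finite hypothesis collection (indexed by `ι`,
`hyp i ⊆ 𝕄`) is partitioned into two disjoint nonempty families `G1` and `G2`.
The critical value is `α / |G1|` for `i ∈ G1` and
`(α · |ℛ ∩ G1|) / (|G2 \ ℛ| · |G1|)` for `i ∈ G2`.  The sequentially rejective
procedure with successor `N(ℛ) = {i ∉ ℛ : p i ≤ α_i(ℛ)}` controls the FWER at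
level `α`. -/
theorem parallel_gatekeeping_fwer_control
    {Ω : Type*} [MeasurableSpace Ω] {𝕄 : Type*} {ι : Type*} [Fintype ι]
    (P : 𝕄 → Measure Ω) (hP : ∀ M, IsProbabilityMeasure (P M))
    (hyp : ι → Set 𝕄) (hproper : ∀ i, hyp i ≠ Set.univ)
    (G1 G2 : Set ι) (hunion : G1 ∪ G2 = Set.univ) (hdisj : G1 ∩ G2 = ∅)
    (hne1 : G1.Nonempty) (hne2 : G2.Nonempty)
    (α : ℝ) (hα0 : 0 ≤ α) (hα1 : α ≤ 1)
    (p : ι → Ω → ℝ) (hpmeas : ∀ i, Measurable (p i))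
    (hprange : ∀ i ω, p i ω ∈ Set.Icc (0 : ℝ) 1)
    (hpval : ∀ (M : 𝕄) (i : ι), M ∈ hyp i → ∀ u ∈ Set.Icc (0 : ℝ) 1,
      P M {ω | p i ω ≤ u} ≤ ENNReal.ofReal u)
    (N : Set ι → Ω → Set ι)
    (hN : ∀ R ω, N R ω = {i | i ∉ R ∧
      p i ω ≤ (if i ∈ G1 then α / (Set.ncard G1 : ℝ)
        else α * (Set.ncard (R ∩ G1) : ℝ) /
          ((Set.ncard (G2 \ R) : ℝ) * (Set.ncard G1 : ℝ)))}) :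
    ∀ M : 𝕄,
      1 - ENNReal.ofReal α ≤ P M {ω | (⋃ n, seqRej N ω n) ⊆ {i | M ∉ hyp i}} := by
  intro M
  have := hP M
  set T : Finset ι := Finset.univ.filter fun i => M ∈ hyp i with hT
  set T₁ := T.filter (· ∈ G1) with hT₁
  set T₂ := T.filter (· ∉ G1) with hT₂
  set m : ℝ := (G1.ncard : ℝ) with hm
  have hG1 : 1 ≤ G1.ncard := (ncard_pos (toFinite G1)).2 hne1
  have hm1 : 1 ≤ m := Nat.one_le_cast.2 hG1
  have hm0 : 0 < m := by linarith
  have hT₁m : (T₁.card : ℝ) ≤ m := by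
    rw [hm, ← ncard_coe_finset T₁]
    exact Nat.cast_le.2 (ncard_le_ncard
      (fun i hi => (Finset.mem_filter.1 (Finset.mem_coe.1 hi)).2) (toFinite G1))
  have hcard : ∀ i ∈ T, i ∉ G1 → (1 : ℝ) ≤ T₂.card := fun i hi hi1 => by
    exact_mod_cast Finset.card_pos.2 ⟨i, Finset.mem_filter.2 ⟨hi, hi1⟩⟩
  set b : ℝ := α * (m - T₁.card) / (T₂.card * m) with hb
  have hb0 : 0 ≤ b := by
    have : 0 ≤ m - T₁.card := by linarith
    positivity
  have hc0 : ∀ i ∈ T, 0 ≤ if i ∈ G1 then α / m else b := fun i _ => by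
    split_ifs
    · positivity
    · exact hb0
  refine one_sub_le_measure_of_compl_subset_biUnion (P M) (T := T)
    (c := fun i => if i ∈ G1 then α / m else b)
    (E := fun i => {ω | p i ω ≤ if i ∈ G1 then α / m else b}) ?_ hc0 ?_ ?_
  · intro ω hω
    obtain ⟨R, hR, i, hi, hiF⟩ := exists_successor_notMem_of_not_iUnion_seqRej_subset hω
    have hiM : M ∈ hyp i := not_not.1 hiF
    have hiT : i ∈ T := by simpa [hT] using hiM
    rw [hN] at hi
    refine mem_iUnion₂.2 ⟨i, hiT, hi.2.trans ?_⟩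
    split_ifs with hi1
    · exact le_rfl
    have h1 : ((R ∩ G1).ncard : ℝ) ≤ m - T₁.card := by
      have hd : Disjoint (R ∩ G1) (T₁ : Set ι) := by
        refine disjoint_left.2 fun j hj hj' => hR hj.1 ?_
        exact (Finset.mem_filter.1 (Finset.mem_filter.1 (Finset.mem_coe.1 hj')).1).2
      have hle : (R ∩ G1 ∪ (T₁ : Set ι)).ncard ≤ G1.ncard :=
        ncard_le_ncard (union_subset inter_subset_right fun j hj =>
          (Finset.mem_filter.1 (Finset.mem_coe.1 hj)).2) (toFinite G1)
      rw [ncard_union_eq hd (toFinite _) (toFinite _), ncard_coe_finset] at hle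
      have : ((R ∩ G1).ncard : ℝ) + T₁.card ≤ m := by
        rw [hm]
        exact_mod_cast hle
      linarith
    have h2 : (T₂.card : ℝ) ≤ (G2 \ R).ncard := by
      rw [← ncard_coe_finset T₂]
      refine Nat.cast_le.2 (ncard_le_ncard (fun j hj => ?_) (toFinite _))
      have hj : M ∈ hyp j ∧ j ∉ G1 := by simpa [hT₂, hT] using hj
      have hju : j ∈ G1 ∪ G2 := hunion ▸ mem_univ j
      exact ⟨hju.resolve_left hj.2, fun hjR => hR hjR hj.1⟩
    have h3 := hcard i hiT hi1
    have h4 : 0 ≤ m - T₁.card := by linarith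
    rw [hb]
    gcongr
  · intro i hi
    refine hpval M i (by simpa [hT] using hi) _ ⟨hc0 i hi, ?_⟩
    split_ifs with hi1
    · rw [div_le_one hm0]
      linarith
    · have h3 := hcard i hi hi1
      rw [hb, div_le_one (by positivity)]
      have h4 : (0 : ℝ) ≤ T₁.card := by positivity
      nlinarith
  · have hs : ∑ i ∈ T, (if i ∈ G1 then α / m else b) = T₁.card * (α / m) + T₂.card * b := by
      rw [Finset.sum_ite, Finset.sum_const, Finset.sum_const, nsmul_eq_mul, nsmul_eq_mul]
    have h2 : T₂.card * b ≤ α * (m - T₁.card) / m := by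
      rcases eq_or_ne (T₂.card : ℝ) 0 with h | h
      · have : 0 ≤ m - T₁.card := by linarith
        rw [h, zero_mul]
        positivity
      · rw [hb]
        exact le_of_eq (by field_simp)
    calc ∑ i ∈ T, (if i ∈ G1 then α / m else b) = T₁.card * (α / m) + T₂.card * b := hs
      _ ≤ T₁.card * (α / m) + α * (m - T₁.card) / m := by gcongr
      _ = α := by field_simp; ring
end

section
/- FWER control of the admissibility-improved tree-based procedure. Let ℋ be a finite collection of null hypotheses structured as a rooted tree (a unique root, each non-root hypothesis having exactly one parent, no cycles) such that every non-leaf hypothesis equals the intersection of its children: H = ⋂ children(H) whenever children(H) ≠ ∅. Let ℒ denote the set of leaves, L = |ℒ|, L_H the number of leaves that are descendants of H (counting H itself if H is a leaf), and for ℛ ⊆ ℋ let 𝒟(ℛ) = {H ∈ ℛ : no descendant of H other than H lies in ℛ} and L''(ℛ) = L − |𝒟(ℛ)|. Suppose raw p-values {p_H}_{H∈ℋ} are given and define α_H(ℛ) = α·L_H / L''(ℛ) if all ancestors of H lie in ℛ and L''(ℛ) > 0, and α_H(ℛ) = 0 otherwise. Then the sequentially rejective procedure with successor function 𝒩(ℛ)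 = {H ∈ ℋ \ ℛ : p_H ≤ α_H(ℛ)} satisfies P_M(ℛ_∞ ⊆ ℱ(M)) ≥ 1 − α for every M ∈ 𝕄; moreover L''(ℛ) ≤ |ℒ \ ℛ| can fail only for sets ℛ that are not of the form ℱ(M), so these critical values are at least as large as those using |ℒ \ ℛ|. -/
open MeasureTheory Set Classical

/-- In a rooted tree given by the parent function `par` with root `root`
(`par root = root`), the node `i` is a leaf iff it has no children. -/
def IsLeaf {ι : Type*} (par : ι → ι) (root : ι) (i : ι) : Prop :=
  ∀ j, par j = i → j = root

/-- `j` is a (weak) descendant of `i`: some iterate of the parent map sends `j`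
to `i` (in particular every node is a descendant of itself). -/
def IsDesc {ι : Type*} (par : ι → ι) (j i : ι) : Prop :=
  ∃ n : ℕ, par^[n] j = i

/-- `j` is an ancestor of `i`: `j ≠ i` and `j` lies on the path from `i`
to the root. -/
def IsAnc {ι : Type*} (par : ι → ι) (j i : ι) : Prop :=
  j ≠ i ∧ IsDesc par i j

/-- `𝒟(ℛ)`: the members of `ℛ` having no descendant other than themselves
inside `ℛ` (the "leaves of the rejected subgraph"). -/
def rejLeaves {ι : Type*} (par : ι → ι) (R : Set ι) : Set ι :=
  {i | i ∈ R ∧ ∀ j, j ≠ i → IsDesc par j i → j ∉ R}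

/-- `L''(ℛ) = L - |𝒟(ℛ)|`. -/
noncomputable def LSharp {ι : Type*} [Fintype ι] (par : ι → ι) (root : ι)
    (R : Set ι) : ℕ :=
  Set.ncard {l | IsLeaf par root l} - Set.ncard (rejLeaves par R)

section TreeOrder

variable {ι : Type*} {par : ι → ι} {root : ι}

lemma IsDesc.refl (i : ι) : IsDesc par i i := ⟨0, rfl⟩

lemma IsDesc.trans {i j k : ι} (h : IsDesc par i j) (h' : IsDesc par j k) : IsDesc par i k := by
  obtain ⟨n, rfl⟩ := h
  obtain ⟨m, rfl⟩ := h'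
  exact ⟨m + n, Function.iterate_add_apply par m n i⟩

lemma IsDesc.antisymm (hroot : par root = root) (hreach : ∀ i, ∃ n : ℕ, par^[n] i = root)
    {i j : ι} (h : IsDesc par i j) (h' : IsDesc par j i) : i = j := by
  obtain ⟨n, hn⟩ := h
  obtain ⟨m, hm⟩ := h'
  have hfix : ∀ q, par^[q] root = root := fun q => Function.iterate_fixed hroot q
  have hcycle : par^[m + n] i = i := by rw [Function.iterate_add_apply, hn, hm]
  rcases Nat.eq_zero_or_pos (m + n) with h0 | hpos
  · obtain rfl : n = 0 := by omega
    exact hn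
  · obtain ⟨q, hq⟩ := hreach i
    have hper : par^[(m + n) * q] i = i := by
      rw [Function.iterate_mul]
      exact Function.iterate_fixed hcycle q
    have hle : q ≤ (m + n) * q := Nat.le_mul_of_pos_left q hpos
    obtain ⟨d, hd⟩ := Nat.exists_eq_add_of_le' hle
    rw [hd, Function.iterate_add_apply, hq, hfix] at hper
    rw [← hn, ← hper, hfix]

lemma IsDesc.total_of_common {l i k : ι} (hi : IsDesc par l i) (hk : IsDesc par l k) :
    IsDesc par i k ∨ IsDesc par k i := by
  obtain ⟨n, rfl⟩ := hi
  obtain ⟨m, rfl⟩ := hk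
  rcases le_total n m with h | h
  · obtain ⟨d, rfl⟩ := Nat.exists_eq_add_of_le' h
    exact Or.inl ⟨d, (Function.iterate_add_apply par d n l).symm⟩
  · obtain ⟨d, rfl⟩ := Nat.exists_eq_add_of_le' h
    exact Or.inr ⟨d, (Function.iterate_add_apply par d m l).symm⟩

lemma exists_isDesc_mem_rejLeaves [Finite ι] (hroot : par root = root)
    (hreach : ∀ i, ∃ n : ℕ, par^[n] i = root) {S : Set ι} {i : ι} (hi : i ∈ S) :
    ∃ j, IsDesc par j i ∧ j ∈ rejLeaves par S := by
  let r : ι → ι → Prop := fun a b => a ≠ b ∧ IsDesc par a b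
  have : Std.Irrefl r := ⟨fun a h => h.1 rfl⟩
  have : IsTrans ι r := ⟨fun a b c hab hbc => ⟨by
    rintro rfl
    exact hab.1 (hab.2.antisymm hroot hreach hbc.2), hab.2.trans hbc.2⟩⟩
  have hwf : WellFounded r := Finite.wellFounded_of_trans_of_irrefl r
  obtain ⟨j, ⟨hjS, hji⟩, hmin⟩ :=
    hwf.has_min {j | j ∈ S ∧ IsDesc par j i} ⟨i, hi, IsDesc.refl i⟩
  exact ⟨j, hji, hjS, fun k hk hkj hkS => hmin k ⟨hkS, hkj.trans hji⟩ ⟨hk, hkj⟩⟩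

lemma isLeaf_of_mem_rejLeaves_univ {j : ι} (hreach : ∀ i, ∃ n : ℕ, par^[n] i = root)
    (hj : j ∈ rejLeaves par univ) : IsLeaf par root j := by
  intro k hk
  have hkj : k = j := by
    by_contra hne
    exact hj.2 k hne ⟨1, hk⟩ (mem_univ k)
  subst hkj
  obtain ⟨n, hn⟩ := hreach k
  rw [← hn, Function.iterate_fixed hk n]

lemma IsLeaf.eq_of_isDesc (hroot : par root = root) {i j : ι} (hi : IsLeaf par root i)
    (h : IsDesc par j i) : j = i := by
  obtain ⟨n, hn⟩ := h
  induction n with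
  | zero => exact hn
  | succ n ih =>
    rw [Function.iterate_succ_apply'] at hn
    have h1 : par^[n] j = root := hi _ hn
    refine ih ?_
    rw [h1, hroot] at hn
    rw [h1, hn]

lemma ncard_rejLeaves_mono [Finite ι] (hroot : par root = root)
    (hreach : ∀ i, ∃ n : ℕ, par^[n] i = root) {R S : Set ι} (hRS : R ⊆ S) :
    (rejLeaves par R).ncard ≤ (rejLeaves par S).ncard := by
  have hex : ∀ i, i ∈ S → ∃ j, IsDesc par j i ∧ j ∈ rejLeaves par S :=
    fun i hi => exists_isDesc_mem_rejLeaves hroot hreach hi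
  choose! f hf using hex
  refine Set.ncard_le_ncard_of_injOn f (fun i hi => (hf i (hRS hi.1)).2) ?_ (Set.toFinite _)
  intro i hi k hk hik
  by_contra hne
  have hi' := (hf i (hRS hi.1)).1
  rw [hik] at hi'
  rcases hi'.total_of_common (hf k (hRS hk.1)).1 with h | h
  · exact hk.2 i hne h hi.1
  · exact hi.2 k (Ne.symm hne) h hk.1

lemma LSharp_anti [Fintype ι] (hroot : par root = root)
    (hreach : ∀ i, ∃ n : ℕ, par^[n] i = root) {R S : Set ι} (hRS : R ⊆ S) :
    LSharp par root S ≤ LSharp par root R :=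
  Nat.sub_le_sub_left (ncard_rejLeaves_mono hroot hreach hRS) _

end TreeOrder

section IntersectionTree

variable {ι 𝕄 : Type*} {par : ι → ι} {root : ι} {hyp : ι → Set 𝕄}

lemma mem_hyp_of_isDesc
    (hinter : ∀ i : ι, ¬ IsLeaf par root i →
      hyp i = ⋂ j ∈ {j : ι | par j = i ∧ j ≠ root}, hyp j)
    (hroot : par root = root) {M : 𝕄} {i j : ι} (hi : M ∈ hyp i) (h : IsDesc par j i) :
    M ∈ hyp j := by
  obtain ⟨n, rfl⟩ := h
  induction n with
  | zero => exact hi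
  | succ n ih =>
    refine ih ?_
    rw [Function.iterate_succ_apply'] at hi
    generalize par^[n] j = k at hi ⊢
    by_cases hk : k = root
    · rwa [hk, hroot, ← hk] at hi
    · rw [hinter (par k) fun hl => hk (hl k rfl)] at hi
      exact mem_iInter₂.1 hi k ⟨rfl, hk⟩

lemma rejLeaves_false
    (hinter : ∀ i : ι, ¬ IsLeaf par root i →
      hyp i = ⋂ j ∈ {j : ι | par j = i ∧ j ≠ root}, hyp j)
    (hroot : par root = root) (hreach : ∀ i, ∃ n : ℕ, par^[n] i = root) (M : 𝕄) :
    rejLeaves par {i | M ∉ hyp i} = {l | IsLeaf par root l} ∩ {i | M ∉ hyp i} := by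
  ext i
  constructor
  · rintro ⟨hi, hmin⟩
    refine ⟨?_, hi⟩
    by_contra hl
    have hi' : M ∉ hyp i := hi
    rw [hinter i hl] at hi'
    simp only [mem_iInter, not_forall] at hi'
    obtain ⟨j, ⟨hj, hjr⟩, hMj⟩ := hi'
    refine hmin j ?_ ⟨1, hj⟩ hMj
    rintro rfl
    obtain ⟨n, hn⟩ := hreach j
    rw [Function.iterate_fixed hj n] at hn
    exact hjr hn
  · rintro ⟨hl, hi⟩
    exact ⟨hi, fun j hj hd => absurd (IsLeaf.eq_of_isDesc hroot hl hd) hj⟩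

lemma LSharp_false [Fintype ι]
    (hinter : ∀ i : ι, ¬ IsLeaf par root i →
      hyp i = ⋂ j ∈ {j : ι | par j = i ∧ j ≠ root}, hyp j)
    (hroot : par root = root) (hreach : ∀ i, ∃ n : ℕ, par^[n] i = root) (M : 𝕄) :
    LSharp par root {i | M ∉ hyp i} =
      ({l | IsLeaf par root l} \ {i | M ∉ hyp i}).ncard := by
  rw [LSharp, rejLeaves_false hinter hroot hreach]
  have := Set.ncard_inter_add_ncard_sdiff_eq_ncard {l | IsLeaf par root l} {i | M ∉ hyp i}
    (Set.toFinite _)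
  omega

lemma sum_ncard_leaves_le [Fintype ι]
    (hinter : ∀ i : ι, ¬ IsLeaf par root i →
      hyp i = ⋂ j ∈ {j : ι | par j = i ∧ j ≠ root}, hyp j)
    (hroot : par root = root) (hreach : ∀ i, ∃ n : ℕ, par^[n] i = root) (M : 𝕄)
    (s : Finset ι) (hs : ∀ i ∈ s, M ∈ hyp i ∧ ∀ j, IsAnc par j i → M ∉ hyp j) :
    ∑ i ∈ s, {l | IsLeaf par root l ∧ IsDesc par l i}.ncard ≤
      LSharp par root {i | M ∉ hyp i} := by
  rw [LSharp_false hinter hroot hreach]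
  simp only [Set.ncard_eq_toFinset_card']
  rw [← Finset.card_biUnion]
  · refine Finset.card_le_card fun l hl => ?_
    simp only [Finset.mem_biUnion, Set.mem_toFinset, Set.mem_ofPred_eq] at hl
    obtain ⟨i, hi, hl, hd⟩ := hl
    simp only [Set.mem_toFinset, Set.mem_sdiff, Set.mem_ofPred_eq, not_not]
    exact ⟨hl, mem_hyp_of_isDesc hinter hroot (hs i hi).1 hd⟩
  · intro i hi k hk hne
    refine Finset.disjoint_left.2 fun l hl hl' => ?_
    simp only [Set.mem_toFinset, Set.mem_ofPred_eq] at hl hl'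
    rcases hl.2.total_of_common hl'.2 with h | h
    · exact (hs i hi).2 k ⟨Ne.symm hne, h⟩ (hs k hk).1
    · exact (hs k hk).2 i ⟨hne, h⟩ (hs i hi).1

lemma LSharp_false_pos [Fintype ι]
    (hinter : ∀ i : ι, ¬ IsLeaf par root i →
      hyp i = ⋂ j ∈ {j : ι | par j = i ∧ j ≠ root}, hyp j)
    (hroot : par root = root) (hreach : ∀ i, ∃ n : ℕ, par^[n] i = root) {M : 𝕄} {i : ι}
    (hi : M ∈ hyp i) : 0 < LSharp par root {i | M ∉ hyp i} := by
  obtain ⟨j, hji, hj⟩ := exists_isDesc_mem_rejLeaves hroot hreach (mem_univ i)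
  rw [LSharp_false hinter hroot hreach, Set.ncard_pos (Set.toFinite _)]
  exact ⟨j, isLeaf_of_mem_rejLeaves_univ hreach hj,
    fun h => h (mem_hyp_of_isDesc hinter hroot hi hji)⟩

end IntersectionTree

/-- The critical value `α_H(ℛ)` of the admissibility-improved tree-based procedure. -/
noncomputable def treeCritValue {ι : Type*} [Fintype ι] (par : ι → ι) (root : ι) (α : ℝ)
    (R : Set ι) (i : ι) : ℝ :=
  if (∀ j, IsAnc par j i → j ∈ R) ∧ 0 < LSharp par root R then
    α * (Set.ncard {l | IsLeaf par root l ∧ IsDesc par l i} : ℝ) / (LSharp par root R : ℝ)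
  else 0

section CriticalValues

variable {ι 𝕄 : Type*} [Fintype ι] {par : ι → ι} {root : ι} {hyp : ι → Set 𝕄} {α : ℝ}

lemma treeCritValue_nonneg (hα0 : 0 ≤ α) (R : Set ι) (i : ι) :
    0 ≤ treeCritValue par root α R i := by
  unfold treeCritValue
  split_ifs
  · positivity
  · exact le_rfl

lemma treeCritValue_le_false
    (hinter : ∀ i : ι, ¬ IsLeaf par root i →
      hyp i = ⋂ j ∈ {j : ι | par j = i ∧ j ≠ root}, hyp j)
    (hroot : par root = root) (hreach : ∀ i, ∃ n : ℕ, par^[n] i = root) (hα0 : 0 ≤ α)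
    {M : 𝕄} {i : ι} (hi : M ∈ hyp i) {R : Set ι} (hR : R ⊆ {i | M ∉ hyp i}) :
    treeCritValue par root α R i ≤ treeCritValue par root α {i | M ∉ hyp i} i := by
  by_cases h : (∀ j, IsAnc par j i → j ∈ R) ∧ 0 < LSharp par root R
  · have hpos := LSharp_false_pos hinter hroot hreach hi
    have hle := LSharp_anti hroot hreach hR
    unfold treeCritValue
    rw [if_pos h, if_pos ⟨fun j hj => hR (h.1 j hj), hpos⟩]
    gcongr
  · conv_lhs => rw [treeCritValue, if_neg h]
    exact treeCritValue_nonneg hα0 _ _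

lemma sum_treeCritValue_false_le
    (hinter : ∀ i : ι, ¬ IsLeaf par root i →
      hyp i = ⋂ j ∈ {j : ι | par j = i ∧ j ≠ root}, hyp j)
    (hroot : par root = root) (hreach : ∀ i, ∃ n : ℕ, par^[n] i = root) (hα0 : 0 ≤ α) (M : 𝕄) :
    ∑ i with M ∈ hyp i, treeCritValue par root α {i | M ∉ hyp i} i ≤ α := by
  let s := Finset.univ.filter fun i => M ∈ hyp i ∧ ∀ j, IsAnc par j i → M ∉ hyp j
  have hs : ∑ i ∈ s, {l | IsLeaf par root l ∧ IsDesc par l i}.ncard ≤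
      LSharp par root {i | M ∉ hyp i} :=
    sum_ncard_leaves_le hinter hroot hreach M s fun i hi => (Finset.mem_filter.1 hi).2
  have hcrit : ∀ i ∈ Finset.univ.filter (fun i => M ∈ hyp i),
      treeCritValue par root α {i | M ∉ hyp i} i =
        if ∀ j, IsAnc par j i → M ∉ hyp j then
          α * ({l | IsLeaf par root l ∧ IsDesc par l i}.ncard : ℝ) /
            (LSharp par root {i | M ∉ hyp i} : ℝ) else 0 := by
    intro i hi
    have hpos := LSharp_false_pos hinter hroot hreach (Finset.mem_filter.1 hi).2
    by_cases h : ∀ j, IsAnc par j i → M ∉ hyp j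
    · rw [treeCritValue, if_pos ⟨h, hpos⟩, if_pos h]
    · rw [treeCritValue, if_neg fun h' => h h'.1, if_neg h]
  rw [Finset.sum_congr rfl hcrit, ← Finset.sum_filter, Finset.filter_filter, ← Finset.sum_div,
    ← Finset.mul_sum]
  refine div_le_of_le_mul₀ (Nat.cast_nonneg _) hα0 (mul_le_mul_of_nonneg_left ?_ hα0)
  exact_mod_cast hs

end CriticalValues

/-- **FWER control of the admissibility-improved tree-based procedure.**
The hypotheses (indexed by the finite type `ι`, `hyp i ⊆ 𝕄`) are structured as a
rooted tree via the parent function `par`, every non-leaf hypothesis being the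
intersection of its children.  With `ℒ` the set of leaves, `L_H` the number of
descendant leaves of `H`, `𝒟(ℛ)` the rejected hypotheses with no rejected proper
descendant, and `L''(ℛ) = L - |𝒟(ℛ)|`, the critical value is `α·L_H / L''(ℛ)`
when all ancestors of `H` lie in `ℛ` and `L''(ℛ) > 0`, and `0` otherwise.  The
sequentially rejective procedure with successor `N(ℛ) = {H ∉ ℛ : p H ≤ α_H(ℛ)}`
controls the FWER at level `α`; moreover, for sets of the form `ℛ = ℱ(M)` one has
`L''(ℛ) ≤ |ℒ \ ℛ|`, so these critical values are at least as large as those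
using `|ℒ \ ℛ|`. -/
theorem meinshausen_tree_admissible_fwer_control
    {Ω : Type*} [MeasurableSpace Ω] {𝕄 : Type*} {ι : Type*} [Fintype ι]
    (P : 𝕄 → Measure Ω) (hP : ∀ M, IsProbabilityMeasure (P M))
    (hyp : ι → Set 𝕄) (hproper : ∀ i, hyp i ≠ Set.univ)
    (root : ι) (par : ι → ι) (hroot : par root = root)
    (hreach : ∀ i : ι, ∃ n : ℕ, par^[n] i = root)
    (hinter : ∀ i : ι, ¬ IsLeaf par root i →
      hyp i = ⋂ j ∈ {j : ι | par j = i ∧ j ≠ root}, hyp j)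
    (α : ℝ) (hα0 : 0 ≤ α) (hα1 : α ≤ 1)
    (p : ι → Ω → ℝ) (hpmeas : ∀ i, Measurable (p i))
    (hprange : ∀ i ω, p i ω ∈ Set.Icc (0 : ℝ) 1)
    (hpval : ∀ (M : 𝕄) (i : ι), M ∈ hyp i → ∀ u ∈ Set.Icc (0 : ℝ) 1,
      P M {ω | p i ω ≤ u} ≤ ENNReal.ofReal u)
    (N : Set ι → Ω → Set ι)
    (hN : ∀ R ω, N R ω = {i | i ∉ R ∧
      p i ω ≤ (if (∀ j, IsAnc par j i → j ∈ R) ∧ 0 < LSharp par root R then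
        α * (Set.ncard {l | IsLeaf par root l ∧ IsDesc par l i} : ℝ) /
          (LSharp par root R : ℝ)
      else 0)}) :
    (∀ M : 𝕄,
      1 - ENNReal.ofReal α ≤
        P M {ω | (⋃ n, seqRej N ω n) ⊆ {i | M ∉ hyp i}}) ∧
    (∀ M : 𝕄,
      LSharp par root {i | M ∉ hyp i} ≤
        Set.ncard ({l | IsLeaf par root l} \ {i | M ∉ hyp i})) := by
  refine ⟨fun M => ?_, fun M => (LSharp_false hinter hroot hreach M).le⟩
  have := hP M
  set c := treeCritValue par root α {i | M ∉ hyp i} with hc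
  have hsum : ∑ i with M ∈ hyp i, c i ≤ α :=
    sum_treeCritValue_false_le hinter hroot hreach hα0 M
  have hc0 : ∀ i, 0 ≤ c i := treeCritValue_nonneg hα0 _
  set B : Set Ω := ⋃ i ∈ Finset.univ.filter (fun i => M ∈ hyp i), {ω | p i ω ≤ c i} with hB
  have hBmeas : MeasurableSet B :=
    Finset.measurableSet_biUnion _ fun i _ => measurableSet_le (hpmeas i) measurable_const
  have hBle : P M B ≤ ENNReal.ofReal α :=
    calc P M B ≤ ∑ i with M ∈ hyp i, P M {ω | p i ω ≤ c i} := measure_biUnion_finset_le _ _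
      _ ≤ ∑ i with M ∈ hyp i, ENNReal.ofReal (c i) := by
        refine Finset.sum_le_sum fun i hi => hpval M i (Finset.mem_filter.1 hi).2 _ ⟨hc0 i, ?_⟩
        exact ((Finset.single_le_sum (fun j _ => hc0 j) hi).trans hsum).trans hα1
      _ = ENNReal.ofReal (∑ i with M ∈ hyp i, c i) :=
        (ENNReal.ofReal_sum_of_nonneg fun i _ => hc0 i).symm
      _ ≤ ENNReal.ofReal α := ENNReal.ofReal_le_ofReal hsum
  calc 1 - ENNReal.ofReal α ≤ 1 - P M B := tsub_le_tsub_left hBle 1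
    _ = P M Bᶜ := (prob_compl_eq_one_sub hBmeas).symm
    _ ≤ _ := measure_mono fun ω hω => ?_
  refine iUnion_subset fun n => ?_
  induction n with
  | zero => exact empty_subset _
  | succ n ih =>
    refine union_subset ih fun i hi hMi => hω ?_
    rw [hN] at hi
    exact mem_iUnion₂.2 ⟨i, Finset.mem_filter.2 ⟨Finset.mem_univ i, hMi⟩,
      hi.2.trans (treeCritValue_le_false hinter hroot hreach hα0 hMi ih)⟩
end
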